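/- For all τ in the complex upper half-plane and all z ∈ ℂ: ϑ01(τ,z)² = η(2τ)·(η(2τ)²/(η(τ)η(4τ)))²·ϑ00(2τ,2z) − 2·η(2τ)·(η(4τ)/η(2τ))²·ϑ10(2τ,2z). -/

import Mathlib

open Complex

/-- Jacobi theta function `θ_{j,m}(τ,z) = Σ_{n ∈ j/(2m)+ℤ} q^{m n²} e^{2πi m n z}`. -/
noncomputable def jTheta (j m : ℝ) (τ z : ℂ) : ℂ :=
  ∑' n : ℤ, Complex.exp (2 * (Real.pi : ℂ) * Complex.I * (m : ℂ) *
    (((j / (2 * m) + (n : ℝ) : ℝ) : ℂ) ^ 2 * τ + ((j / (2 * m) + (n : ℝ) : ℝ) : ℂ) * z))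

/-- `q^a := e^{2πiaτ}`. -/
noncomputable def qpow (τ : ℂ) (a : ℝ) : ℂ :=
  Complex.exp (2 * (Real.pi : ℂ) * Complex.I * (a : ℂ) * τ)

/-- Dedekind eta function. -/
noncomputable def dedekindEta (τ : ℂ) : ℂ :=
  Complex.exp ((Real.pi : ℂ) * Complex.I * τ / 12) *
    ∏' n : ℕ, (1 - Complex.exp (2 * (Real.pi : ℂ) * Complex.I * ((n : ℂ) + 1) * τ))

/-- Mumford theta `ϑ00`. -/
noncomputable def v00 (τ z : ℂ) : ℂ := jTheta 0 2 τ z + jTheta 2 2 τ z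
/-- Mumford theta `ϑ01`. -/
noncomputable def v01 (τ z : ℂ) : ℂ := jTheta 0 2 τ z - jTheta 2 2 τ z
/-- Mumford theta `ϑ10`. -/
noncomputable def v10 (τ z : ℂ) : ℂ := jTheta 1 2 τ z + jTheta (-1) 2 τ z

open Filter
open scoped Real Topology

/-- The finite product `∏_{i=1}^{n} (1 - x^i)`. -/
noncomputable def qFactorial (x : ℂ) (n : ℕ) : ℂ := ∏ i ∈ Finset.range n, (1 - x ^ (i + 1))

/-- Euler's product `∏_{i ≥ 1} (1 - x^i)`. -/
noncomputable def eulerProduct (x : ℂ) : ℂ := ∏' i : ℕ, (1 - x ^ (i + 1))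

/-- The inverse of `qFactorial`, extended by zero to negative integers. -/
noncomputable def qFactorialInv (x : ℂ) (n : ℤ) : ℂ :=
  if n < 0 then 0 else (qFactorial x n.toNat)⁻¹

/-- The central Gaussian binomial coefficient `[2N choose N + k]` with parameter `x`. -/
noncomputable def centralQBinom (x : ℂ) (N : ℕ) (k : ℤ) : ℂ :=
  qFactorial x (2 * N) * qFactorialInv x (N - k) * qFactorialInv x (N + k)

section EulerProduct

variable {x : ℂ}

lemma one_sub_pow_succ_ne_zero (hx : ‖x‖ < 1) (n : ℕ) : 1 - x ^ (n + 1) ≠ 0 := by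
  intro h
  have h1 : ‖x ^ (n + 1)‖ = 1 := by rw [← sub_eq_zero.mp h, norm_one]
  rw [norm_pow] at h1
  exact (pow_lt_one₀ (norm_nonneg x) hx n.succ_ne_zero).ne h1

lemma summable_norm_pow_succ (hx : ‖x‖ < 1) : Summable fun n : ℕ ↦ ‖x ^ (n + 1)‖ := by
  simpa using (summable_nat_add_iff 1).mpr (summable_geometric_of_lt_one (norm_nonneg x) hx)

lemma eulerProduct_ne_zero (hx : ‖x‖ < 1) : eulerProduct x ≠ 0 := by
  have := tprod_one_add_ne_zero_of_summable (f := fun n : ℕ ↦ -x ^ (n + 1))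
    (fun n ↦ by simpa [← sub_eq_add_neg] using one_sub_pow_succ_ne_zero hx n)
    (by simpa using summable_norm_pow_succ hx)
  simpa [eulerProduct, sub_eq_add_neg] using this

lemma qFactorial_ne_zero (hx : ‖x‖ < 1) (n : ℕ) : qFactorial x n ≠ 0 :=
  Finset.prod_ne_zero_iff.mpr fun i _ ↦ one_sub_pow_succ_ne_zero hx i

lemma tendsto_qFactorial (hx : ‖x‖ < 1) :
    Tendsto (qFactorial x) atTop (𝓝 (eulerProduct x)) :=
  (ModularForm.multipliable_one_sub_pow hx).tendsto_prod_tprod_nat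

lemma qFactorialInv_sub_one (hx : ‖x‖ < 1) (n : ℤ) :
    qFactorialInv x (n - 1) = (1 - x ^ n) * qFactorialInv x n := by
  rcases lt_trichotomy n 0 with h | rfl | h
  · simp [qFactorialInv, h, show n - 1 < 0 by lia]
  · simp [qFactorialInv]
  · obtain ⟨m, rfl⟩ : ∃ m : ℕ, n = m + 1 := ⟨(n - 1).toNat, by lia⟩
    have h1 : ¬ ((m : ℤ) + 1 < 0) := by lia
    have h2 : ((m : ℤ) + 1).toNat = m + 1 := by lia
    have h3 : x ^ ((m : ℤ) + 1) = x ^ (m + 1) := by exact_mod_cast zpow_natCast x (m + 1)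
    have := one_sub_pow_succ_ne_zero hx m
    have := qFactorial_ne_zero hx m
    have h4 : qFactorial x (m + 1) = qFactorial x m * (1 - x ^ (m + 1)) :=
      Finset.prod_range_succ _ _
    simp only [qFactorialInv, add_sub_cancel_right, h1, h2, h3, h4, if_false, Int.toNat_natCast,
      show ¬ ((m : ℤ) < 0) by lia]
    field_simp

lemma centralQBinom_succ (hx : ‖x‖ < 1) (hx0 : x ≠ 0) (N : ℕ) (k : ℤ) :
    centralQBinom x (N + 1) k = (1 + x ^ (2 * N + 1)) * centralQBinom x N k +
      x ^ ((N : ℤ) + 1 - k) * centralQBinom x N (k - 1) +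
      x ^ ((N : ℤ) + 1 + k) * centralQBinom x N (k + 1) := by
  have e1 : qFactorialInv x (N - k) =
      (1 - x ^ ((N : ℤ) + 1 - k)) * qFactorialInv x (N + 1 - k) := by
    rw [← qFactorialInv_sub_one hx]; congr 1; ring
  have e2 : qFactorialInv x (N + k) =
      (1 - x ^ ((N : ℤ) + 1 + k)) * qFactorialInv x (N + 1 + k) := by
    rw [← qFactorialInv_sub_one hx]; congr 1; ring
  have e3 : qFactorialInv x (N + (k - 1)) =
      (1 - x ^ ((N : ℤ) + 1 + k) / x) * qFactorialInv x (N + k) := by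
    rw [div_eq_mul_inv, ← zpow_sub_one₀ hx0, show (N : ℤ) + 1 + k - 1 = N + k by ring,
      ← qFactorialInv_sub_one hx]; congr 1; ring
  have e4 : qFactorialInv x (N - (k + 1)) =
      (1 - x ^ ((N : ℤ) + 1 - k) / x) * qFactorialInv x (N - k) := by
    rw [div_eq_mul_inv, ← zpow_sub_one₀ hx0, show (N : ℤ) + 1 - k - 1 = N - k by ring,
      ← qFactorialInv_sub_one hx]; congr 1; ring
  have e5 : (N : ℤ) - (k - 1) = N + 1 - k := by ring
  have e6 : (N : ℤ) + (k + 1) = N + 1 + k := by ring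
  have h : x ^ ((N : ℤ) + 1 - k) * x ^ ((N : ℤ) + 1 + k) = x ^ (2 * N + 1) * x := by
    rw [← zpow_add₀ hx0, ← pow_succ, ← zpow_natCast]; congr 1; push_cast; ring
  have h' : qFactorial x (2 * (N + 1)) =
      qFactorial x (2 * N) * (1 - x ^ (2 * N + 1)) * (1 - x ^ (2 * N + 1) * x) := by
    rw [mul_add, mul_one, qFactorial, Finset.prod_range_succ, Finset.prod_range_succ,
      ← qFactorial]
    ring
  simp only [centralQBinom, e3, e4, e5, e6, Nat.cast_add, Nat.cast_one]
  rw [e1, e2, h']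
  generalize x ^ ((N : ℤ) + 1 - k) = u at *
  generalize x ^ ((N : ℤ) + 1 + k) = v at *
  have h'' : x ^ (2 * N + 1) = u * v / x := by rw [h]; field_simp
  rw [h'']
  field_simp
  ring

lemma exists_norm_qFactorial_le (hx : ‖x‖ < 1) : ∃ C, ∀ n, ‖qFactorial x n‖ ≤ C := by
  obtain ⟨C, hC⟩ := (tendsto_qFactorial hx).norm.bddAbove_range
  exact ⟨C, fun n ↦ hC ⟨n, rfl⟩⟩

lemma exists_norm_qFactorialInv_le (hx : ‖x‖ < 1) :
    ∃ C, 0 ≤ C ∧ ∀ n, ‖qFactorialInv x n‖ ≤ C := by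
  obtain ⟨C, hC⟩ := ((tendsto_qFactorial hx).inv₀ (eulerProduct_ne_zero hx)).norm.bddAbove_range
  have hC' : ∀ n, ‖(qFactorial x n)⁻¹‖ ≤ C := fun n ↦ hC ⟨n, rfl⟩
  have h0 : 0 ≤ C := (norm_nonneg _).trans (hC' 0)
  refine ⟨C, h0, fun n ↦ ?_⟩
  unfold qFactorialInv
  split_ifs
  · simpa using h0
  · exact hC' _

lemma exists_norm_centralQBinom_le (hx : ‖x‖ < 1) : ∃ C, ∀ N k, ‖centralQBinom x N k‖ ≤ C := by
  obtain ⟨C, hC⟩ := exists_norm_qFactorial_le hx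
  obtain ⟨D, hD, hD'⟩ := exists_norm_qFactorialInv_le hx
  have hC0 : 0 ≤ C := (norm_nonneg _).trans (hC 0)
  refine ⟨C * D * D, fun N k ↦ ?_⟩
  rw [centralQBinom, norm_mul, norm_mul]
  gcongr <;> apply_rules

lemma tendsto_qFactorialInv (hx : ‖x‖ < 1) :
    Tendsto (qFactorialInv x) atTop (𝓝 (eulerProduct x)⁻¹) := by
  have h : Tendsto (fun n : ℤ ↦ (qFactorial x n.toNat)⁻¹) atTop (𝓝 (eulerProduct x)⁻¹) :=
    ((tendsto_qFactorial hx).comp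
      (tendsto_atTop.mpr fun b ↦ (eventually_ge_atTop (b : ℤ)).mono fun n hn ↦ by lia)).inv₀
      (eulerProduct_ne_zero hx)
  refine h.congr' ((eventually_ge_atTop 0).mono fun n hn ↦ ?_)
  simp [qFactorialInv, not_lt.mpr hn]

lemma tendsto_centralQBinom (hx : ‖x‖ < 1) (k : ℤ) :
    Tendsto (fun N ↦ centralQBinom x N k) atTop (𝓝 (eulerProduct x)⁻¹) := by
  have h0 : Tendsto (fun N : ℕ ↦ 2 * N) atTop atTop :=
    tendsto_id.const_mul_atTop' two_pos
  have h1 : Tendsto (fun N : ℕ ↦ (N : ℤ) - k) atTop atTop :=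
    tendsto_atTop_add_const_right _ (-k) tendsto_natCast_atTop_atTop
  have h2 : Tendsto (fun N : ℕ ↦ (N : ℤ) + k) atTop atTop :=
    tendsto_atTop_add_const_right _ k tendsto_natCast_atTop_atTop
  have := (((tendsto_qFactorial hx).comp h0).mul ((tendsto_qFactorialInv hx).comp h1)).mul
    ((tendsto_qFactorialInv hx).comp h2)
  rwa [mul_inv_cancel₀ (eulerProduct_ne_zero hx), one_mul] at this

end EulerProduct

section TripleProduct

variable {q : ℂ}

/-- The finite form of the Jacobi triple product identity. -/
lemma hasSum_centralQBinom (hq : ‖q‖ < 1) (hq0 : q ≠ 0) {z : ℂ} (hz : z ≠ 0) (N : ℕ) :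
    HasSum (fun k : ℤ ↦ centralQBinom (q ^ 2) N k * (q ^ (k ^ 2) * z ^ k))
      (∏ i ∈ Finset.range N, (1 + z * q ^ (2 * i + 1)) * (1 + z⁻¹ * q ^ (2 * i + 1))) := by
  have hx : ‖q ^ 2‖ < 1 := by rw [norm_pow]; exact pow_lt_one₀ (norm_nonneg q) hq two_ne_zero
  induction N with
  | zero =>
    have h := hasSum_ite_eq (0 : ℤ) (1 : ℂ)
    convert h using 2 with k
    on_goal 2 => simp
    split_ifs with hk
    · simp [hk, centralQBinom, qFactorialInv, qFactorial]
    · rcases lt_or_gt_of_ne hk with hk | hk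
      · simp [centralQBinom, qFactorialInv, hk]
      · simp [centralQBinom, qFactorialInv, hk]
  | succ N ih =>
    have h1 := ih.mul_left (1 + q ^ (2 * (2 * N + 1)))
    have h2 := ((Equiv.subRight (1 : ℤ)).hasSum_iff.mpr ih).mul_left (z * q ^ (2 * N + 1))
    have h3 := ((Equiv.addRight (1 : ℤ)).hasSum_iff.mpr ih).mul_left (z⁻¹ * q ^ (2 * N + 1))
    rw [Finset.prod_range_succ]
    have hzz : z * z⁻¹ = 1 := mul_inv_cancel₀ hz
    refine (congrArg₂ (HasSum · ·) ?_ ?_).mpr ((h1.add h2).add h3)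
    · ext k
      have e (a : ℤ) : (q ^ 2) ^ a = q ^ (2 * a) := by rw [zpow_mul]; rfl
      have p1 : q ^ (2 * ((N : ℤ) + 1 - k)) * q ^ (k ^ 2) =
          q ^ (2 * N + 1) * q ^ ((k - 1) ^ 2) := by
        rw [← zpow_natCast, ← zpow_add₀ hq0, ← zpow_add₀ hq0]; congr 1; push_cast; ring
      have p2 : q ^ (2 * ((N : ℤ) + 1 + k)) * q ^ (k ^ 2) =
          q ^ (2 * N + 1) * q ^ ((k + 1) ^ 2) := by
        rw [← zpow_natCast, ← zpow_add₀ hq0, ← zpow_add₀ hq0]; congr 1; push_cast; ring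
      have z1 : z ^ (k - 1) = z ^ k * z⁻¹ := by rw [zpow_sub_one₀ hz]
      have z2 : z ^ (k + 1) = z ^ k * z := by rw [zpow_add_one₀ hz]
      simp only [Function.comp_apply, Equiv.subRight_apply, Equiv.coe_addRight, z1, z2]
      rw [centralQBinom_succ hx (pow_ne_zero 2 hq0), e, e, ← pow_mul]
      linear_combination (centralQBinom (q ^ 2) N (k - 1) * z ^ k) * p1 +
        (centralQBinom (q ^ 2) N (k + 1) * z ^ k) * p2 -
        (centralQBinom (q ^ 2) N (k - 1) * z ^ k * q ^ (2 * N + 1) * q ^ ((k - 1) ^ 2) +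
          centralQBinom (q ^ 2) N (k + 1) * z ^ k * q ^ (2 * N + 1) * q ^ ((k + 1) ^ 2)) * hzz
    · linear_combination ((∏ i ∈ Finset.range N, (1 + z * q ^ (2 * i + 1)) *
        (1 + z⁻¹ * q ^ (2 * i + 1))) * q ^ (2 * (2 * N + 1))) * hzz

lemma multipliable_one_add_mul_pow_odd (hq : ‖q‖ < 1) (z : ℂ) :
    Multipliable fun i : ℕ ↦ 1 + z * q ^ (2 * i + 1) := by
  apply multipliable_one_add_of_summable
  simp only [norm_mul]
  exact ((summable_norm_pow_succ hq).comp_injective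
    (i := fun i : ℕ ↦ 2 * i) (fun a b h ↦ by simpa using h)).mul_left _

lemma jacobiTheta₂_term_eq (k : ℤ) (w τ : ℂ) :
    jacobiTheta₂_term k w τ = cexp (π * I * τ) ^ (k ^ 2) * cexp (2 * π * I * w) ^ k := by
  rw [jacobiTheta₂_term, ← exp_int_mul, ← exp_int_mul, ← Complex.exp_add]
  congr 1; push_cast; ring

lemma norm_exp_pi_mul_I_lt_one {τ : ℂ} (hτ : 0 < τ.im) : ‖cexp (π * I * τ)‖ < 1 := by
  rw [norm_exp, Real.exp_lt_one_iff]
  simpa using mul_pos Real.pi_pos hτ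

/-- The Jacobi triple product identity. -/
theorem jacobiTheta₂_eq_tripleProduct {τ : ℂ} (hτ : 0 < τ.im) (w : ℂ) {q z : ℂ}
    (hq : q = cexp (π * I * τ)) (hz : z = cexp (2 * π * I * w)) :
    jacobiTheta₂ w τ = eulerProduct (q ^ 2) *
      ((∏' i : ℕ, (1 + z * q ^ (2 * i + 1))) * ∏' i : ℕ, (1 + z⁻¹ * q ^ (2 * i + 1))) := by
  have hq1 : ‖q‖ < 1 := hq ▸ norm_exp_pi_mul_I_lt_one hτ
  have hx : ‖q ^ 2‖ < 1 := by rw [norm_pow]; exact pow_lt_one₀ (norm_nonneg q) hq1 two_ne_zero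
  have hq0 : q ≠ 0 := hq ▸ exp_ne_zero _
  have hz0 : z ≠ 0 := hz ▸ exp_ne_zero _
  obtain ⟨C, hC⟩ := exists_norm_centralQBinom_le hx
  have hs := ((summable_jacobiTheta₂_term_iff w τ).mpr hτ).norm.mul_left C
  have hlim := tendsto_tsum_of_dominated_convergence (𝓕 := atTop)
    (f := fun N k ↦ centralQBinom (q ^ 2) N k * jacobiTheta₂_term k w τ)
    (g := fun k ↦ (eulerProduct (q ^ 2))⁻¹ * jacobiTheta₂_term k w τ) hs
    (fun k ↦ (tendsto_centralQBinom hx k).mul_const _)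
    (.of_forall fun N k ↦ by rw [norm_mul]; gcongr; exact hC N k)
  simp_rw [jacobiTheta₂_term_eq, ← hq, ← hz,
    (hasSum_centralQBinom hq1 hq0 hz0 _).tsum_eq] at hlim
  have hprod := (multipliable_one_add_mul_pow_odd hq1 z).tendsto_prod_tprod_nat.mul
    (multipliable_one_add_mul_pow_odd hq1 z⁻¹).tendsto_prod_tprod_nat
  simp_rw [← Finset.prod_mul_distrib] at hprod
  rw [← tendsto_nhds_unique hlim hprod, tsum_mul_left,
    mul_inv_cancel_left₀ (eulerProduct_ne_zero hx), jacobiTheta₂]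
  simp_rw [jacobiTheta₂_term_eq, ← hq, ← hz]

end TripleProduct

section OneAdd

variable {q : ℂ}

lemma multipliable_one_add_pow_succ (hq : ‖q‖ < 1) : Multipliable fun i : ℕ ↦ 1 + q ^ (i + 1) :=
  multipliable_one_add_of_summable (summable_norm_pow_succ hq)

lemma tprod_one_add_pow_succ (hq : ‖q‖ < 1) :
    ∏' i : ℕ, (1 + q ^ (i + 1)) = eulerProduct (q ^ 2) / eulerProduct q := by
  rw [eq_div_iff (eulerProduct_ne_zero hq), eulerProduct, eulerProduct,
    ← (multipliable_one_add_pow_succ hq).tprod_mul (ModularForm.multipliable_one_sub_pow hq)]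
  exact tprod_congr fun i ↦ by ring

lemma tprod_one_add_pow_odd (hq : ‖q‖ < 1) :
    ∏' i : ℕ, (1 + q ^ (2 * i + 1)) =
      eulerProduct (q ^ 2) ^ 2 / (eulerProduct q * eulerProduct (q ^ 4)) := by
  have hq2 : ‖q ^ 2‖ < 1 := by rw [norm_pow]; exact pow_lt_one₀ (norm_nonneg q) hq two_ne_zero
  have hq4 : ‖q ^ 4‖ < 1 := by rw [norm_pow]; exact pow_lt_one₀ (norm_nonneg q) hq four_ne_zero
  have he (i : ℕ) : q ^ (2 * i + 1 + 1) = (q ^ 2) ^ (i + 1) := by rw [← pow_mul]; ring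
  have h := tprod_even_mul_odd (f := fun i : ℕ ↦ 1 + q ^ (i + 1))
    (by simpa using multipliable_one_add_mul_pow_odd hq 1)
    (by simpa only [he] using multipliable_one_add_pow_succ hq2)
  simp only [he] at h
  rw [tprod_one_add_pow_succ hq, tprod_one_add_pow_succ hq2, ← pow_mul] at h
  have h1 := eulerProduct_ne_zero hq
  have h2 := eulerProduct_ne_zero hq2
  have h4 := eulerProduct_ne_zero hq4
  norm_num at h
  field_simp at h ⊢
  exact h

lemma tprod_one_add_self_mul_pow_odd (hq : ‖q‖ < 1) (hq0 : q ≠ 0) :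
    (∏' i : ℕ, (1 + q * q ^ (2 * i + 1))) * ∏' i : ℕ, (1 + q⁻¹ * q ^ (2 * i + 1)) =
      2 * (eulerProduct (q ^ 4) / eulerProduct (q ^ 2)) ^ 2 := by
  have hq2 : ‖q ^ 2‖ < 1 := by rw [norm_pow]; exact pow_lt_one₀ (norm_nonneg q) hq two_ne_zero
  have e1 (i : ℕ) : q * q ^ (2 * i + 1) = (q ^ 2) ^ (i + 1) := by rw [← pow_mul]; ring
  have e2 (i : ℕ) : q⁻¹ * q ^ (2 * i + 1) = (q ^ 2) ^ i := by
    rw [← pow_mul, pow_succ']; field_simp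
  have h : ∏' i : ℕ, (1 + (q ^ 2) ^ i) = (1 + (q ^ 2) ^ 0) * ∏' i : ℕ, (1 + (q ^ 2) ^ (i + 1)) :=
    tprod_eq_zero_mul' (multipliable_one_add_pow_succ hq2)
  simp only [e1, e2]
  rw [h, tprod_one_add_pow_succ hq2, ← pow_mul, pow_zero]
  ring

end OneAdd

section ThetaNullvalues

variable {τ : ℂ}

lemma dedekindEta_eq (τ : ℂ) :
    dedekindEta τ = cexp (π * I * τ / 12) * eulerProduct (cexp (2 * π * I * τ)) := by
  rw [dedekindEta, eulerProduct]
  congr 1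
  refine tprod_congr fun n ↦ ?_
  rw [← Complex.exp_nat_mul]
  congr 2; push_cast; ring

lemma dedekindEta_natCast_mul (n : ℕ) (τ : ℂ) :
    dedekindEta (n * τ) = cexp (π * I * τ / 12) ^ n * eulerProduct (cexp (2 * π * I * τ) ^ n) := by
  rw [dedekindEta_eq, ← Complex.exp_nat_mul, ← Complex.exp_nat_mul]
  congr 2 <;> ring_nf

lemma norm_exp_two_pi_I_mul_lt_one (hτ : 0 < τ.im) : ‖cexp (2 * π * I * τ)‖ < 1 := by
  simpa using UpperHalfPlane.norm_exp_two_pi_I_lt_one ⟨τ, hτ⟩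

lemma jacobiTheta₂_zero_two_mul (hτ : 0 < τ.im) :
    jacobiTheta₂ 0 (2 * τ) = dedekindEta (2 * τ) *
      (dedekindEta (2 * τ) ^ 2 / (dedekindEta τ * dedekindEta (4 * τ))) ^ 2 := by
  have hq := norm_exp_two_pi_I_mul_lt_one hτ
  have h1 := dedekindEta_natCast_mul 1 τ
  have h2 := dedekindEta_natCast_mul 2 τ
  have h4 := dedekindEta_natCast_mul 4 τ
  norm_num at h1 h2 h4
  rw [jacobiTheta₂_eq_tripleProduct (q := cexp (2 * π * I * τ)) (z := 1) (by simpa using hτ) 0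
    (by ring_nf) (by simp), inv_one]
  simp only [one_mul]
  rw [tprod_one_add_pow_odd hq, h1, h2, h4]
  generalize hr : cexp (π * I * τ / 12) = r
  have : r ≠ 0 := hr ▸ exp_ne_zero _
  field_simp

lemma exp_mul_jacobiTheta₂_two_mul (hτ : 0 < τ.im) :
    cexp (π * I * τ / 2) * jacobiTheta₂ τ (2 * τ) =
      2 * dedekindEta (2 * τ) * (dedekindEta (4 * τ) / dedekindEta (2 * τ)) ^ 2 := by
  have hq := norm_exp_two_pi_I_mul_lt_one hτ
  have h2 := dedekindEta_natCast_mul 2 τ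
  have h4 := dedekindEta_natCast_mul 4 τ
  norm_num at h2 h4
  rw [jacobiTheta₂_eq_tripleProduct (q := cexp (2 * π * I * τ)) (z := cexp (2 * π * I * τ))
    (by simpa using hτ) τ (by ring_nf) rfl, h2, h4]
  have hr' : cexp (π * I * τ / 2) = cexp (π * I * τ / 12) ^ 6 := by
    rw [← Complex.exp_nat_mul]; congr 1; push_cast; ring
  rw [hr']
  generalize hr : cexp (π * I * τ / 12) = r
  have : r ≠ 0 := hr ▸ exp_ne_zero _
  rw [tprod_one_add_self_mul_pow_odd hq (exp_ne_zero _)]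
  field_simp

end ThetaNullvalues

section Square

/-- The map `(s, t) ↦ (s + t, s - t)` on the first copy of `ℤ × ℤ` and
`(s, t) ↦ (s + t + 1, s - t)` on the second one. -/
def sumDiffEquiv : (ℤ × ℤ) ⊕ (ℤ × ℤ) ≃ ℤ × ℤ where
  toFun := Sum.elim (fun p ↦ (p.1 + p.2, p.1 - p.2)) (fun p ↦ (p.1 + p.2 + 1, p.1 - p.2))
  invFun p := if Even (p.1 + p.2) then .inl ((p.1 + p.2) / 2, (p.1 - p.2) / 2)
    else .inr ((p.1 + p.2 - 1) / 2, (p.1 - p.2 - 1) / 2)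
  left_inv := by
    rintro (⟨s, t⟩ | ⟨s, t⟩)
    · simp only [Sum.elim_inl, Int.even_iff]
      rw [if_pos (by lia)]
      congr 2 <;> lia
    · simp only [Sum.elim_inr, Int.even_iff]
      rw [if_neg (by lia)]
      congr 2 <;> lia
  right_inv := by
    rintro ⟨k, l⟩
    dsimp only
    split_ifs with h <;> rw [Int.even_iff] at h
    · exact Prod.ext (by simp only [Sum.elim_inl]; lia) (by simp only [Sum.elim_inl]; lia)
    · exact Prod.ext (by simp only [Sum.elim_inr]; lia) (by simp only [Sum.elim_inr]; lia)

lemma HasSum.mul_of_summable_norm {ι κ : Type*} {f : ι → ℂ} {g : κ → ℂ} {a b : ℂ}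
    (hf : HasSum f a) (hg : HasSum g b) (hf' : Summable fun i ↦ ‖f i‖)
    (hg' : Summable fun i ↦ ‖g i‖) : HasSum (fun p : ι × κ ↦ f p.1 * g p.2) (a * b) :=
  hf.mul hg (summable_mul_of_summable_norm hf' hg')

lemma hasSum_jacobiTheta₂_mul {τ σ : ℂ} (hτ : 0 < τ.im) (hσ : 0 < σ.im) (z w : ℂ) :
    HasSum (fun p : ℤ × ℤ ↦ jacobiTheta₂_term p.1 z τ * jacobiTheta₂_term p.2 w σ)
      (jacobiTheta₂ z τ * jacobiTheta₂ w σ) :=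
  HasSum.mul_of_summable_norm (f := fun n ↦ jacobiTheta₂_term n z τ)
    (g := fun n ↦ jacobiTheta₂_term n w σ)
    (hasSum_jacobiTheta₂_term z hτ) (hasSum_jacobiTheta₂_term w hσ)
    ((summable_jacobiTheta₂_term_iff z τ).mpr hτ).norm
    ((summable_jacobiTheta₂_term_iff w σ).mpr hσ).norm

lemma jacobiTheta₂_sq {τ : ℂ} (hτ : 0 < τ.im) (z : ℂ) :
    jacobiTheta₂ z τ ^ 2 = jacobiTheta₂ (2 * z) (2 * τ) * jacobiTheta₂ 0 (2 * τ) +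
      cexp (2 * π * I * z + π * I * τ) *
        (jacobiTheta₂ (2 * z + τ) (2 * τ) * jacobiTheta₂ τ (2 * τ)) := by
  have h2 : 0 < (2 * τ).im := by simpa using hτ
  have h := sumDiffEquiv.hasSum_iff.mpr (hasSum_jacobiTheta₂_mul hτ hτ z z)
  rw [sq]
  refine h.unique (HasSum.sum ?_ ?_)
  · refine (congrArg (HasSum · _) (funext fun p ↦ ?_)).mpr (hasSum_jacobiTheta₂_mul h2 h2 (2 * z) 0)
    simp only [Function.comp_apply, sumDiffEquiv, Equiv.coe_fn_mk, Sum.elim_inl,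
      jacobiTheta₂_term, ← Complex.exp_add]
    congr 1; push_cast; ring
  · refine (congrArg (HasSum · _) (funext fun p ↦ ?_)).mpr
      ((hasSum_jacobiTheta₂_mul h2 h2 (2 * z + τ) τ).mul_left (cexp (2 * π * I * z + π * I * τ)))
    simp only [Function.comp_apply, sumDiffEquiv, Equiv.coe_fn_mk, Sum.elim_inr,
      jacobiTheta₂_term, ← Complex.exp_add]
    congr 1; push_cast; ring

end Square

section Mumford

variable {τ : ℂ}

lemma HasSum.int_even_add_odd {f : ℤ → ℂ} {a b : ℂ} (he : HasSum (fun n ↦ f (2 * n)) a)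
    (ho : HasSum (fun n ↦ f (2 * n + 1)) b) : HasSum f (a + b) := by
  have hi : Function.Injective fun n : ℤ ↦ 2 * n := mul_right_injective₀ two_ne_zero
  replace ho := ((add_left_injective 1).comp hi).hasSum_range_iff.2 ho
  refine (hi.hasSum_range_iff.2 he).add_isCompl ?_ ho
  simpa [Function.comp_def] using Int.isCompl_even_odd

lemma summable_jacobiTheta₂_term_comp (hτ : 0 < τ.im) (z : ℂ) {e : ℤ → ℤ}
    (he : Function.Injective e) : Summable fun n ↦ jacobiTheta₂_term (e n) z τ :=
  ((summable_jacobiTheta₂_term_iff z τ).mpr hτ).comp_injective he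

lemma jTheta_zero_two (τ z : ℂ) : jTheta 0 2 τ z = ∑' n : ℤ, jacobiTheta₂_term (2 * n) z τ := by
  refine tsum_congr fun n ↦ ?_
  rw [jacobiTheta₂_term]
  congr 1; push_cast; ring

lemma jTheta_two_two (τ z : ℂ) :
    jTheta 2 2 τ z = ∑' n : ℤ, jacobiTheta₂_term (2 * n + 1) z τ := by
  refine tsum_congr fun n ↦ ?_
  rw [jacobiTheta₂_term]
  congr 1; push_cast; ring

lemma jTheta_one_two (τ z : ℂ) :
    jTheta 1 2 τ z = cexp (π * I * τ / 4 + π * I * z) *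
      ∑' n : ℤ, jacobiTheta₂_term (2 * n) (z + τ / 2) τ := by
  rw [← tsum_mul_left]
  refine tsum_congr fun n ↦ ?_
  rw [jacobiTheta₂_term, ← Complex.exp_add]
  congr 1; push_cast; ring

lemma jTheta_neg_one_two (τ z : ℂ) :
    jTheta (-1) 2 τ z = cexp (π * I * τ / 4 + π * I * z) *
      ∑' n : ℤ, jacobiTheta₂_term (2 * n + 1) (z + τ / 2) τ := by
  rw [← tsum_mul_left, jTheta, ← (Equiv.addRight (1 : ℤ)).tsum_eq]
  refine tsum_congr fun n ↦ ?_
  rw [jacobiTheta₂_term, ← Complex.exp_add, Equiv.coe_addRight]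
  congr 1; push_cast; ring

lemma jacobiTheta₂_eq_even_add_odd (hτ : 0 < τ.im) (z : ℂ) :
    jacobiTheta₂ z τ = ∑' n : ℤ, jacobiTheta₂_term (2 * n) z τ +
      ∑' n : ℤ, jacobiTheta₂_term (2 * n + 1) z τ :=
  (HasSum.int_even_add_odd (f := fun n ↦ jacobiTheta₂_term n z τ)
    (summable_jacobiTheta₂_term_comp hτ z fun a b h ↦ by lia).hasSum
    (summable_jacobiTheta₂_term_comp hτ z fun a b h ↦ by lia).hasSum).tsum_eq

lemma v00_eq_jacobiTheta₂ (hτ : 0 < τ.im) (z : ℂ) : v00 τ z = jacobiTheta₂ z τ := by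
  rw [v00, jTheta_zero_two, jTheta_two_two, jacobiTheta₂_eq_even_add_odd hτ]

lemma v10_eq_jacobiTheta₂ (hτ : 0 < τ.im) (z : ℂ) :
    v10 τ z = cexp (π * I * τ / 4 + π * I * z) * jacobiTheta₂ (z + τ / 2) τ := by
  rw [v10, jTheta_one_two, jTheta_neg_one_two, jacobiTheta₂_eq_even_add_odd hτ, mul_add]

lemma v01_eq_jacobiTheta₂ (hτ : 0 < τ.im) (z : ℂ) : v01 τ z = jacobiTheta₂ (z + 1 / 2) τ := by
  have h (n : ℤ) : jacobiTheta₂_term n (z + 1 / 2) τ =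
      (-1) ^ n * jacobiTheta₂_term n z τ := by
    rw [← exp_pi_mul_I, ← exp_int_mul, jacobiTheta₂_term, jacobiTheta₂_term, ← Complex.exp_add]
    congr 1; ring
  have he (n : ℤ) : (-1 : ℂ) ^ (2 * n) = 1 := (even_two_mul n).neg_one_zpow
  have ho (n : ℤ) : (-1 : ℂ) ^ (2 * n + 1) = -1 := (odd_two_mul_add_one n).neg_one_zpow
  rw [v01, jTheta_zero_two, jTheta_two_two, jacobiTheta₂_eq_even_add_odd hτ]
  simp only [h, he, ho, one_mul, neg_mul, tsum_neg, sub_eq_add_neg]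

end Mumford

/-- Lemma 2.2 (3): `ϑ01(τ,z)²`. -/
theorem stmt_3 (τ : ℂ) (hτ : 0 < τ.im) (z : ℂ) :
    v01 τ z ^ 2 =
      dedekindEta (2 * τ) *
          (dedekindEta (2 * τ) ^ 2 / (dedekindEta τ * dedekindEta (4 * τ))) ^ 2 *
          v00 (2 * τ) (2 * z)
        - 2 * dedekindEta (2 * τ) * (dedekindEta (4 * τ) / dedekindEta (2 * τ)) ^ 2 *
          v10 (2 * τ) (2 * z) := by
  have h2 : 0 < (2 * τ).im := by simpa using hτ
  have hp : jacobiTheta₂ (2 * (z + 1 / 2)) (2 * τ) = jacobiTheta₂ (2 * z) (2 * τ) := by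
    rw [← jacobiTheta₂_add_left (2 * z)]; congr 1; ring
  have hp' : jacobiTheta₂ (2 * (z + 1 / 2) + τ) (2 * τ) =
      jacobiTheta₂ (2 * z + 2 * τ / 2) (2 * τ) := by
    rw [← jacobiTheta₂_add_left (2 * z + 2 * τ / 2)]; congr 1; ring
  have he : cexp (2 * π * I * (z + 1 / 2) + π * I * τ) =
      -(cexp (π * I * τ / 2) * cexp (π * I * (2 * τ) / 4 + π * I * (2 * z))) := by
    rw [← Complex.exp_add, ← neg_one_mul, ← exp_pi_mul_I, ← Complex.exp_add]
    congr 1; ring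
  rw [v01_eq_jacobiTheta₂ hτ, jacobiTheta₂_sq hτ, v00_eq_jacobiTheta₂ h2, v10_eq_jacobiTheta₂ h2,
    ← jacobiTheta₂_zero_two_mul hτ, ← exp_mul_jacobiTheta₂_two_mul hτ, hp, hp', he]
  ring
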